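/- For every 0 < α < n/2 and A > 0, the capacity is upper-bounded as C_{h,σ²}(A, αA) ≤ (1/2)·log(1 + V_max(A, αA)/σ²). -/

import Mathlib

open MeasureTheory ProbabilityTheory Real Filter
open scoped NNReal ENNReal Classical

noncomputable section

/-- Kullback–Leibler divergence (Mathlib's `ProbabilityTheory.klDiv`). -/
def klDiv {α : Type*} [MeasurableSpace α] (μ ν : Measure α) : EReal :=
  if μ ≪ ν ∧ Integrable (llr μ ν) μ then ((∫ x, llr μ ν x ∂μ : ℝ) : EReal) else ⊤

/-- Mutual information of a joint law: KL divergence of the joint law from the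
product of its marginals. -/
def mutualInfo {α β : Type*} [MeasurableSpace α] [MeasurableSpace β]
    (joint : Measure (α × β)) : EReal :=
  klDiv joint ((joint.map Prod.fst).prod (joint.map Prod.snd))

/-- Partial sums `s_k = h_1 + ⋯ + h_k`. -/
def sCum {n : ℕ} (h : Fin n → ℝ) (k : ℕ) : ℝ :=
  ∑ i : Fin n, if i.val < k then h i else 0

/-- Joint law of `(X, Y)` with `Y = hᵀX + Z`, `Z ~ N(0, v)` independent of `X`. -/
def misoJoint {n : ℕ} (h : Fin n → ℝ) (v : ℝ≥0) (μ : Measure (Fin n → ℝ)) :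
    Measure ((Fin n → ℝ) × ℝ) :=
  (μ.prod (gaussianReal 0 v)).map (fun p => (p.1, (∑ k, h k * p.1 k) + p.2))

/-- MISO capacity under peak-power constraint `A` and average-power constraint `E`. -/
def misoCapacity {n : ℕ} (h : Fin n → ℝ) (v : ℝ≥0) (A E : ℝ) : EReal :=
  ⨆ μ ∈ {μ : Measure (Fin n → ℝ) | IsProbabilityMeasure μ ∧
      (∀ k, ∀ᵐ x ∂μ, x k ∈ Set.Icc 0 A) ∧ (∑ k, ∫ x, x k ∂μ) ≤ E},
    mutualInfo (misoJoint h v μ)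

/-- MISO capacity under only an average-power constraint `E`. -/
def misoCapacityAvg {n : ℕ} (h : Fin n → ℝ) (v : ℝ≥0) (E : ℝ) : EReal :=
  ⨆ μ ∈ {μ : Measure (Fin n → ℝ) | IsProbabilityMeasure μ ∧
      (∀ k, ∀ᵐ x ∂μ, 0 ≤ x k) ∧ (∑ k, ∫ x, x k ∂μ) ≤ E},
    mutualInfo (misoJoint h v μ)

/-- Joint law of `(X̄, X̄ + Z)` for the unit-gain SISO channel. -/
def sisoJoint (v : ℝ≥0) (μ : Measure ℝ) : Measure (ℝ × ℝ) :=
  (μ.prod (gaussianReal 0 v)).map (fun p => (p.1, p.1 + p.2))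

/-- Unit-gain SISO capacity under peak-power constraint `A` and average-power
constraint `E`. -/
def sisoCapacity (v : ℝ≥0) (A E : ℝ) : EReal :=
  ⨆ μ ∈ {μ : Measure ℝ | IsProbabilityMeasure μ ∧
      (∀ᵐ x ∂μ, x ∈ Set.Icc 0 A) ∧ (∫ x, x ∂μ) ≤ E},
    mutualInfo (sisoJoint v μ)

/-- Unit-gain SISO capacity under only an average-power constraint `E`. -/
def sisoCapacityAvg (v : ℝ≥0) (E : ℝ) : EReal :=
  ⨆ μ ∈ {μ : Measure ℝ | IsProbabilityMeasure μ ∧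
      (∀ᵐ x ∂μ, 0 ≤ x) ∧ (∫ x, x ∂μ) ≤ E},
    mutualInfo (sisoJoint v μ)

/-- The interval `(s_{k-1} A, s_k A]` (with the first one being `[0, s_1 A]`)
corresponding to the event `U = k` (0-indexed: `k ∈ Fin n` stands for `k+1`). -/
def uInterval {n : ℕ} (h : Fin n → ℝ) (A : ℝ) (k : Fin n) : Set ℝ :=
  if k.val = 0 then Set.Icc 0 (sCum h 1 * A)
  else Set.Ioc (sCum h k.val * A) (sCum h (k.val + 1) * A)

/-- The average input power `∑_k p_k ((E[X̄ | U=k] - A s_{k-1})/h_k + (k-1) A)`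
consumed to generate a scalar law of `X̄`. -/
def avgPowerUse {n : ℕ} (h : Fin n → ℝ) (A : ℝ) (μ : Measure ℝ) : ℝ :=
  ∑ k : Fin n,
    (((∫ x in uInterval h A k, x ∂μ) - A * sCum h k.val * (μ (uInterval h A k)).toReal) / h k
      + (k.val : ℝ) * A * (μ (uInterval h A k)).toReal)

/-- The threshold `α_th`. -/
def alphaTh {n : ℕ} (h : Fin n → ℝ) : ℝ :=
  1 / 2 + (1 / sCum h n) * ∑ k : Fin n, h k * (k.val : ℝ)


/-- A scalar law is admissible if it is a probability measure, is supported on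
nonnegative reals, puts no mass above `s_n A`, and respects the average-power
constraint `αA`. -/
def scalarAdmissible {n : ℕ} (h : Fin n → ℝ) (A αA : ℝ) (μ : Measure ℝ) : Prop :=
  IsProbabilityMeasure μ ∧ (∀ᵐ x ∂μ, 0 ≤ x) ∧ μ {x | sCum h n * A < x} = 0 ∧
    avgPowerUse h A μ ≤ αA

/-- The maximum variance `V_max(A, αA)`. -/
def Vmax {n : ℕ} (h : Fin n → ℝ) (A αA : ℝ) : ℝ :=
  sSup ((fun μ : Measure ℝ => variance id μ) '' {μ | scalarAdmissible h A αA μ})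

end

/-- Golden-formula bound: replacing the output marginal by any other law increases the divergence. -/
lemma klDiv_prod_marginals_le {𝓧 𝓨 : Type*} [MeasurableSpace 𝓧] [MeasurableSpace 𝓨]
    [StandardBorelSpace 𝓧] [Nonempty 𝓧] (J : Measure (𝓧 × 𝓨)) [IsProbabilityMeasure J]
    (R : Measure 𝓨) [IsProbabilityMeasure R] :
    InformationTheory.klDiv J (J.fst.prod J.snd) ≤ InformationTheory.klDiv J (J.fst.prod R) := by
  have : IsProbabilityMeasure (J.map Prod.swap) :=
    Measure.isProbabilityMeasure_map measurable_swap.aemeasurable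
  have hdis : (J.map Prod.swap).fst ⊗ₘ (J.map Prod.swap).condKernel = J.map Prod.swap :=
    (J.map Prod.swap).disintegrate _
  rw [Measure.fst_map_swap] at hdis
  have hchain := InformationTheory.klDiv_compProd_eq_add J.snd R
    (J.map Prod.swap).condKernel (Kernel.const 𝓨 J.fst)
  rw [hdis, Measure.compProd_const, Measure.compProd_const] at hchain
  have hswap (K : Measure (𝓧 × 𝓨)) : (K.map Prod.swap).map Prod.swap = K := by
    rw [Measure.map_map measurable_swap measurable_swap]; simp
  calc InformationTheory.klDiv J (J.fst.prod J.snd)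
      = InformationTheory.klDiv ((J.map Prod.swap).map Prod.swap)
          ((J.snd.prod J.fst).map Prod.swap) := by rw [hswap, Measure.prod_swap]
    _ ≤ InformationTheory.klDiv (J.map Prod.swap) (J.snd.prod J.fst) :=
        InformationTheory.klDiv_map_le _ _ measurable_swap
    _ ≤ InformationTheory.klDiv (J.map Prod.swap) (R.prod J.fst) := hchain ▸ le_add_self
    _ = InformationTheory.klDiv (J.map Prod.swap) ((J.fst.prod R).map Prod.swap) := by
        rw [Measure.prod_swap]
    _ ≤ InformationTheory.klDiv J (J.fst.prod R) :=
        InformationTheory.klDiv_map_le _ _ measurable_swap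

lemma gaussianReal_withDensity_ratio (m a : ℝ) {v w : ℝ≥0} (hv : v ≠ 0) (hw : w ≠ 0) :
    (gaussianReal m w).withDensity
      (fun y => ENNReal.ofReal (gaussianPDFReal a v y / gaussianPDFReal m w y))
      = gaussianReal a v := by
  have hρ : Measurable fun y =>
      ENNReal.ofReal (gaussianPDFReal a v y / gaussianPDFReal m w y) :=
    ((measurable_gaussianPDFReal a v).div (measurable_gaussianPDFReal m w)).ennreal_ofReal
  rw [gaussianReal_of_var_ne_zero _ hw, gaussianReal_of_var_ne_zero _ hv,
    ← withDensity_mul _ (measurable_gaussianPDF m w) hρ]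
  congr 1
  ext y
  have hpos := gaussianPDFReal_pos m w y hw
  rw [Pi.mul_apply, gaussianPDF, gaussianPDF, ← ENNReal.ofReal_mul hpos.le,
    mul_div_cancel₀ _ hpos.ne']

/-- The joint law of input and output of an additive Gaussian channel with signal `f`, as a density
with respect to the product of the input law with a reference Gaussian. -/
lemma map_add_gaussian_eq_withDensity {𝓧 : Type*} [MeasurableSpace 𝓧] (μ : Measure 𝓧)
    [SFinite μ] {f : 𝓧 → ℝ} (hf : Measurable f) (m : ℝ) {v w : ℝ≥0} (hv : v ≠ 0) (hw : w ≠ 0) :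
    (μ.prod (gaussianReal 0 v)).map (fun p => (p.1, f p.1 + p.2))
      = (μ.prod (gaussianReal m w)).withDensity
        (fun p => ENNReal.ofReal (gaussianPDFReal (f p.1) v p.2 / gaussianPDFReal m w p.2)) := by
  have hρ : Measurable fun p : 𝓧 × ℝ =>
      ENNReal.ofReal (gaussianPDFReal (f p.1) v p.2 / gaussianPDFReal m w p.2) := by
    simp only [gaussianPDFReal]; fun_prop
  have hmap : Measurable fun p : 𝓧 × ℝ => (p.1, f p.1 + p.2) := by fun_prop
  ext S hS
  rw [Measure.map_apply hmap hS, Measure.prod_apply (hmap hS), withDensity_apply _ hS,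
    ← lintegral_indicator hS, lintegral_prod _ (hρ.indicator hS).aemeasurable]
  refine lintegral_congr fun x => ?_
  have hSx : MeasurableSet (Prod.mk x ⁻¹' S) := measurable_prodMk_left hS
  have h1 := gaussianReal_map_const_add (μ := 0) (v := v) (f x)
  rw [zero_add] at h1
  calc gaussianReal 0 v (Prod.mk x ⁻¹' ((fun p : 𝓧 × ℝ => (p.1, f p.1 + p.2)) ⁻¹' S))
      = gaussianReal (f x) v (Prod.mk x ⁻¹' S) := by
        rw [← h1, Measure.map_apply (by fun_prop) hSx]; rfl
    _ = ∫⁻ y in Prod.mk x ⁻¹' S,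
          ENNReal.ofReal (gaussianPDFReal (f x) v y / gaussianPDFReal m w y)
            ∂(gaussianReal m w) := by
        rw [← gaussianReal_withDensity_ratio m (f x) hv hw, withDensity_apply _ hSx]
    _ = _ := by
        rw [← lintegral_indicator hSx]; rfl

lemma log_gaussianPDFReal_div (m a y : ℝ) {v w : ℝ≥0} (hv : v ≠ 0) (hw : w ≠ 0) :
    Real.log (gaussianPDFReal a v y / gaussianPDFReal m w y)
      = 1 / 2 * Real.log (w / v) - (y - a) ^ 2 / (2 * v) + (y - m) ^ 2 / (2 * w) := by
  have hv' : (0 : ℝ) < v := by positivity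
  have hw' : (0 : ℝ) < w := by positivity
  rw [Real.log_div (gaussianPDFReal_pos a v y hv).ne' (gaussianPDFReal_pos m w y hw).ne']
  simp only [gaussianPDFReal]
  rw [Real.log_mul (by positivity) (by positivity), Real.log_mul (by positivity) (by positivity),
    Real.log_exp, Real.log_exp, Real.log_inv, Real.log_inv, Real.log_sqrt (by positivity),
    Real.log_sqrt (by positivity), Real.log_mul (by positivity) hv'.ne',
    Real.log_mul (by positivity) hw'.ne', Real.log_div hw'.ne' hv'.ne']
  ring

/-- Divergence of the joint law of a Gaussian channel from the product of the input law with the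
Gaussian that matches the first two moments of the output. -/
lemma klDiv_gaussian_channel {𝓧 : Type*} [MeasurableSpace 𝓧] (μ : Measure 𝓧)
    [IsProbabilityMeasure μ] {f : 𝓧 → ℝ} (hf : Measurable f) (hf2 : MemLp f 2 μ)
    {v w : ℝ≥0} (hv : v ≠ 0) (hw : (w : ℝ) = Var[f; μ] + v) :
    InformationTheory.klDiv ((μ.prod (gaussianReal 0 v)).map (fun p => (p.1, f p.1 + p.2)))
      (μ.prod (gaussianReal μ[f] w)) = ENNReal.ofReal (1 / 2 * Real.log (1 + Var[f; μ] / v)) := by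
  have hv' : (0 : ℝ) < v := by positivity
  have hw' : (0 : ℝ) < w := by rw [hw]; linarith [variance_nonneg f μ]
  have hw0 : w ≠ 0 := by exact_mod_cast hw'.ne'
  set m := μ[f] with hm
  have hmap : Measurable fun p : 𝓧 × ℝ => (p.1, f p.1 + p.2) := by fun_prop
  have hJ := map_add_gaussian_eq_withDensity μ hf m hv hw0
  set J := (μ.prod (gaussianReal 0 v)).map (fun p => (p.1, f p.1 + p.2)) with hJdef
  have : IsProbabilityMeasure J := Measure.isProbabilityMeasure_map hmap.aemeasurable
  have hρ : Measurable fun p : 𝓧 × ℝ =>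
      ENNReal.ofReal (gaussianPDFReal (f p.1) v p.2 / gaussianPDFReal m w p.2) := by
    simp only [gaussianPDFReal]; fun_prop
  have hac : J ≪ μ.prod (gaussianReal m w) := by
    rw [hJ]; exact withDensity_absolutelyContinuous _ _
  let F : 𝓧 × ℝ → ℝ := fun p =>
    1 / 2 * Real.log (w / v) - (p.2 - f p.1) ^ 2 / (2 * v) + (p.2 - m) ^ 2 / (2 * w)
  have hF : Measurable F := by fun_prop
  have hllr : llr J (μ.prod (gaussianReal m w)) =ᵐ[J] F := by
    have h1 := Measure.rnDeriv_withDensity (μ.prod (gaussianReal m w)) hρ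
    rw [← hJ] at h1
    filter_upwards [hac.ae_le h1] with p hp
    rw [llr, hp, ENNReal.toReal_ofReal (div_nonneg (gaussianPDFReal_nonneg _ _ _)
      (gaussianPDFReal_nonneg _ _ _)), log_gaussianPDFReal_div _ _ _ hv hw0]
  have hcomp (p : 𝓧 × ℝ) : F (p.1, f p.1 + p.2) = 1 / 2 * Real.log (w / v) - p.2 ^ 2 / (2 * v)
      + ((f p.1 - m) ^ 2 + 2 * ((f p.1 - m) * p.2) + p.2 ^ 2) / (2 * w) := by
    simp only [F]; ring
  have hX : MemLp (fun x => f x - m) 2 μ := hf2.sub (memLp_const m)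
  have hZ : MemLp (fun z : ℝ => z) 2 (gaussianReal 0 v) := memLp_id_gaussianReal 2
  have iX2 : Integrable (fun p : 𝓧 × ℝ => (f p.1 - m) ^ 2) (μ.prod (gaussianReal 0 v)) :=
    hX.integrable_sq.comp_fst _
  have iZ2 : Integrable (fun p : 𝓧 × ℝ => p.2 ^ 2) (μ.prod (gaussianReal 0 v)) :=
    hZ.integrable_sq.comp_snd _
  have iXZ : Integrable (fun p : 𝓧 × ℝ => (f p.1 - m) * p.2) (μ.prod (gaussianReal 0 v)) :=
    (hX.integrable (by norm_num)).mul_prod (hZ.integrable (by norm_num))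
  have eX2 : ∫ p, (f p.1 - m) ^ 2 ∂(μ.prod (gaussianReal 0 v)) = Var[f; μ] := by
    rw [integral_fun_fst (fun x => (f x - m) ^ 2), variance_eq_integral hf.aemeasurable]
    simp [hm]
  have eZ2 : ∫ p, p.2 ^ 2 ∂(μ.prod (gaussianReal 0 v)) = v := by
    rw [integral_fun_snd (fun z : ℝ => z ^ 2)]
    have := variance_fun_id_gaussianReal (μ := 0) (v := v)
    rw [variance_eq_integral (by fun_prop), integral_id_gaussianReal] at this
    simpa using this
  have eXZ : ∫ p, (f p.1 - m) * p.2 ∂(μ.prod (gaussianReal 0 v)) = 0 := by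
    rw [integral_prod_mul (fun x => f x - m) (fun z : ℝ => z), integral_id_gaussianReal, mul_zero]
  have iXZ' : Integrable (fun p : 𝓧 × ℝ => (f p.1 - m) ^ 2 + 2 * ((f p.1 - m) * p.2))
      (μ.prod (gaussianReal 0 v)) := iX2.add (iXZ.const_mul 2)
  have iquad : Integrable (fun p : 𝓧 × ℝ =>
      ((f p.1 - m) ^ 2 + 2 * ((f p.1 - m) * p.2) + p.2 ^ 2) / (2 * w))
      (μ.prod (gaussianReal 0 v)) := (iXZ'.add iZ2).div_const _
  have ilin : Integrable (fun p : 𝓧 × ℝ => 1 / 2 * Real.log (w / v) - p.2 ^ 2 / (2 * v))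
      (μ.prod (gaussianReal 0 v)) := (integrable_const _).sub (iZ2.div_const _)
  have hFint : Integrable F J := by
    rw [hJdef, integrable_map_measure hF.aestronglyMeasurable hmap.aemeasurable]
    refine (ilin.add iquad).congr (Eventually.of_forall fun p => ?_)
    simp [hcomp]
  have hFval : ∫ p, F p ∂J = 1 / 2 * Real.log (1 + Var[f; μ] / v) := by
    rw [hJdef, integral_map hmap.aemeasurable hF.aestronglyMeasurable]
    simp_rw [hcomp]
    rw [integral_add ilin iquad, integral_sub (integrable_const _) (iZ2.div_const _),
      integral_div, integral_div, integral_add iXZ' iZ2,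
      integral_add iX2 (iXZ.const_mul 2),
      integral_const_mul 2 fun p : 𝓧 × ℝ => (f p.1 - m) * p.2, eX2, eZ2, eXZ]
    simp only [integral_const, probReal_univ, one_smul]
    rw [show 1 + Var[f; μ] / v = (w : ℝ) / v by rw [hw]; field_simp; ring]
    have : Var[f; μ] + 2 * 0 + (v : ℝ) = w := by rw [hw]; ring
    rw [this]
    field_simp
    ring
  rw [InformationTheory.klDiv_of_ac_of_integrable hac (hFint.congr hllr.symm),
    integral_congr_ae hllr, hFval]
  simp

lemma mutualInfo_misoJoint_le {n : ℕ} (h : Fin n → ℝ) {v : ℝ≥0} (hv : v ≠ 0)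
    (μ : Measure (Fin n → ℝ)) [IsProbabilityMeasure μ]
    (hf2 : MemLp (fun x => ∑ k, h k * x k) 2 μ) :
    mutualInfo (misoJoint h v μ)
      ≤ ((1 / 2 * Real.log (1 + Var[fun x => ∑ k, h k * x k; μ] / v) : ℝ) : EReal) := by
  have hf : Measurable fun x : Fin n → ℝ => ∑ k, h k * x k := by fun_prop
  have hmap : Measurable fun p : (Fin n → ℝ) × ℝ => (p.1, (∑ k, h k * p.1 k) + p.2) := by fun_prop
  have hJ : IsProbabilityMeasure (misoJoint h v μ) :=
    Measure.isProbabilityMeasure_map hmap.aemeasurable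
  have hfst : (misoJoint h v μ).fst = μ := by
    rw [Measure.fst, misoJoint, Measure.map_map measurable_fst hmap]
    exact Measure.fst_prod
  have hV := variance_nonneg (fun x : Fin n → ℝ => ∑ k, h k * x k) μ
  have hw : ((Var[fun x => ∑ k, h k * x k; μ].toNNReal + v : ℝ≥0) : ℝ)
      = Var[fun x => ∑ k, h k * x k; μ] + v := by simp [hV]
  have hle := klDiv_prod_marginals_le (misoJoint h v μ)
    (gaussianReal μ[fun x => ∑ k, h k * x k]
      (Var[fun x => ∑ k, h k * x k; μ].toNNReal + v))
  have hkl := klDiv_gaussian_channel μ hf hf2 hv hw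
  replace hle := hle.trans_eq (Eq.trans (by rw [hfst]; rfl) hkl)
  obtain ⟨hac, hint⟩ := InformationTheory.klDiv_ne_top_iff.1 (ne_top_of_le_ne_top ENNReal.ofReal_ne_top hle)
  have heq := InformationTheory.toReal_klDiv_of_measure_eq hac (by simp)
  change klDiv (misoJoint h v μ) ((misoJoint h v μ).fst.prod (misoJoint h v μ).snd) ≤ _
  rw [klDiv, if_pos ⟨hac, hint⟩, EReal.coe_le_coe_iff, ← heq]
  refine ENNReal.toReal_le_of_le_ofReal ?_ hle
  have : 0 ≤ Var[fun x => ∑ k, h k * x k; μ] / (v : ℝ) := by positivity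
  have := Real.log_nonneg (by linarith : 1 ≤ 1 + Var[fun x => ∑ k, h k * x k; μ] / (v : ℝ))
  linarith

lemma sCum_mono {n : ℕ} {h : Fin n → ℝ} (hpos : ∀ k, 0 < h k) : Monotone (sCum h) := by
  intro a b hab
  refine Finset.sum_le_sum fun i _ => ?_
  have := hpos i
  split_ifs <;> first | omega | linarith

lemma sCum_self {n : ℕ} (h : Fin n → ℝ) : sCum h n = ∑ i, h i := by
  simp [sCum]

lemma measurableSet_uInterval {n : ℕ} (h : Fin n → ℝ) (A : ℝ) (k : Fin n) :
    MeasurableSet (uInterval h A k) := by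
  unfold uInterval
  split_ifs <;> measurability

lemma pairwise_disjoint_uInterval {n : ℕ} {h : Fin n → ℝ} (hpos : ∀ k, 0 < h k) {A : ℝ}
    (hA : 0 ≤ A) : Pairwise fun i j => Disjoint (uInterval h A i) (uInterval h A j) := by
  have hlt (i j : Fin n) (hij : i < j) : Disjoint (uInterval h A i) (uInterval h A j) := by
    have hij' : i.val < j.val := hij
    have hs : sCum h (i.val + 1) * A ≤ sCum h j.val * A :=
      mul_le_mul_of_nonneg_right (sCum_mono hpos hij') hA
    refine Set.disjoint_left.2 fun x hxi hxj => ?_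
    rw [uInterval, if_neg (by omega)] at hxj
    have hx : x ≤ sCum h (i.val + 1) * A := by
      rw [uInterval] at hxi
      split_ifs at hxi with h0
      · simpa [h0] using hxi.2
      · exact hxi.2
    linarith [hxj.1]
  intro i j hij
  rcases lt_or_gt_of_ne hij with hij | hij
  · exact hlt i j hij
  · exact (hlt j i hij).symm

/-- Each affine piece of the power cost of `X̄ = hᵀx` lower-bounds the total power of `x`. -/
lemma affine_cost_le_sum {n : ℕ} {h : Fin n → ℝ} (hord : ∀ i j : Fin n, i ≤ j → h j ≤ h i)
    (hpos : ∀ k, 0 < h k) {A : ℝ} (k : Fin n) {x : Fin n → ℝ} (hx : ∀ i, x i ∈ Set.Icc 0 A) :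
    ((∑ i, h i * x i) - A * sCum h k.val) / h k + (k.val : ℝ) * A ≤ ∑ i, x i := by
  have hcard : (k.val : ℝ) = ∑ i : Fin n, if i.val < k.val then (1 : ℝ) else 0 := by
    rw [Finset.sum_boole, show (Finset.univ.filter fun i : Fin n => i.val < k.val) = Finset.Iio k by
      ext i; simp, Fin.card_Iio]
  have hterm : (∑ i, h i * x i) - A * sCum h k.val + (k.val : ℝ) * A * h k
      ≤ (∑ i, x i) * h k := by
    rw [hcard, sCum, Finset.mul_sum, Finset.sum_mul, Finset.sum_mul, Finset.sum_mul,
      ← Finset.sum_sub_distrib, ← Finset.sum_add_distrib]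
    refine Finset.sum_le_sum fun i _ => ?_
    obtain ⟨h0, hA⟩ := hx i
    split_ifs with hik
    · have := hord i k (le_of_lt hik)
      nlinarith
    · have := hord k i (not_lt.1 hik)
      nlinarith
  have hk := hpos k
  rw [← le_sub_iff_add_le, div_le_iff₀ hk]
  linarith

lemma avgPowerUse_map_le {n : ℕ} {h : Fin n → ℝ} (hord : ∀ i j : Fin n, i ≤ j → h j ≤ h i)
    (hpos : ∀ k, 0 < h k) {A : ℝ} (hA : 0 ≤ A) (μ : Measure (Fin n → ℝ)) [IsProbabilityMeasure μ]
    (hμ : ∀ᵐ x ∂μ, ∀ k, x k ∈ Set.Icc 0 A) :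
    avgPowerUse h A (μ.map fun x => ∑ k, h k * x k) ≤ ∑ k, ∫ x, x k ∂μ := by
  have hf : Measurable fun x : Fin n → ℝ => ∑ k, h k * x k := by fun_prop
  have hx (k : Fin n) : Integrable (fun x : Fin n → ℝ => x k) μ := by
    refine Integrable.of_bound (measurable_pi_apply k).aestronglyMeasurable A ?_
    filter_upwards [hμ] with x hx
    rw [Real.norm_of_nonneg (hx k).1]
    exact (hx k).2
  have hfi : Integrable (fun x : Fin n → ℝ => ∑ k, h k * x k) μ :=
    integrable_finsetSum _ fun k _ => (hx k).const_mul _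
  have hsum : Integrable (fun x : Fin n → ℝ => ∑ k, x k) μ :=
    integrable_finsetSum _ fun k _ => hx k
  let T (k : Fin n) : Set (Fin n → ℝ) := (fun x => ∑ k, h k * x k) ⁻¹' uInterval h A k
  have hT (k : Fin n) : MeasurableSet (T k) := hf (measurableSet_uInterval h A k)
  have hterm (k : Fin n) :
      ((∫ x in uInterval h A k, x ∂(μ.map fun x => ∑ k, h k * x k))
          - A * sCum h k.val * ((μ.map fun x => ∑ k, h k * x k) (uInterval h A k)).toReal) / h k
        + (k.val : ℝ) * A * ((μ.map fun x => ∑ k, h k * x k) (uInterval h A k)).toReal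
      ≤ ∫ x in T k, ∑ i, x i ∂μ := by
    have hset : ∫ x in uInterval h A k, x ∂(μ.map fun x => ∑ k, h k * x k)
        = ∫ x in T k, ∑ i, h i * x i ∂μ :=
      setIntegral_map (measurableSet_uInterval h A k) aestronglyMeasurable_id hf.aemeasurable
    rw [hset, Measure.map_apply hf (measurableSet_uInterval h A k)]
    have hdiv : IntegrableOn (fun x => ((∑ i, h i * x i) - A * sCum h k.val) / h k) (T k) μ :=
      (hfi.integrableOn.sub (integrable_const _)).div_const _
    have hint : ∫ x in T k, (((∑ i, h i * x i) - A * sCum h k.val) / h k + (k.val : ℝ) * A) ∂μ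
        = ((∫ x in T k, ∑ i, h i * x i ∂μ) - A * sCum h k.val * (μ (T k)).toReal) / h k
          + (k.val : ℝ) * A * (μ (T k)).toReal := by
      rw [integral_add hdiv (integrable_const _), integral_div,
        integral_sub hfi.integrableOn (integrable_const _)]
      simp only [integral_const, smul_eq_mul, Measure.real, Measure.restrict_apply_univ]
      ring
    rw [← hint]
    refine integral_mono_ae (hdiv.add (integrable_const _)) hsum.integrableOn ?_
    filter_upwards [ae_restrict_of_ae hμ] with x hx using affine_cost_le_sum hord hpos k hx
  calc avgPowerUse h A (μ.map fun x => ∑ k, h k * x k)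
      ≤ ∑ k, ∫ x in T k, ∑ i, x i ∂μ := Finset.sum_le_sum fun k _ => hterm k
    _ = ∫ x in ⋃ k, T k, ∑ i, x i ∂μ :=
        (integral_iUnion_fintype hT
          (fun i j hij => (pairwise_disjoint_uInterval hpos hA hij).preimage _)
          fun _ => hsum.integrableOn).symm
    _ ≤ ∫ x, ∑ i, x i ∂μ := by
        refine setIntegral_le_integral hsum ?_
        filter_upwards [hμ] with x hx using Finset.sum_nonneg fun k _ => (hx k).1
    _ = ∑ k, ∫ x, x k ∂μ := integral_finsetSum _ fun k _ => hx k

lemma sum_mul_mem_Icc {n : ℕ} {h : Fin n → ℝ} (hpos : ∀ k, 0 < h k) {A : ℝ} {x : Fin n → ℝ}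
    (hx : ∀ k, x k ∈ Set.Icc 0 A) : ∑ k, h k * x k ∈ Set.Icc 0 (sCum h n * A) := by
  rw [sCum_self, Finset.sum_mul]
  exact ⟨Finset.sum_nonneg fun k _ => mul_nonneg (hpos k).le (hx k).1,
    Finset.sum_le_sum fun k _ => mul_le_mul_of_nonneg_left (hx k).2 (hpos k).le⟩

lemma scalarAdmissible_map {n : ℕ} {h : Fin n → ℝ} (hord : ∀ i j : Fin n, i ≤ j → h j ≤ h i)
    (hpos : ∀ k, 0 < h k) {A E : ℝ} (hA : 0 ≤ A) (μ : Measure (Fin n → ℝ))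
    [IsProbabilityMeasure μ] (hμ : ∀ᵐ x ∂μ, ∀ k, x k ∈ Set.Icc 0 A)
    (hE : ∑ k, ∫ x, x k ∂μ ≤ E) :
    scalarAdmissible h A E (μ.map fun x => ∑ k, h k * x k) := by
  have hf : Measurable fun x : Fin n → ℝ => ∑ k, h k * x k := by fun_prop
  refine ⟨Measure.isProbabilityMeasure_map hf.aemeasurable, ?_, ?_,
    (avgPowerUse_map_le hord hpos hA μ hμ).trans hE⟩
  · rw [ae_map_iff hf.aemeasurable measurableSet_Ici]
    filter_upwards [hμ] with x hx using (sum_mul_mem_Icc hpos hx).1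
  · rw [Measure.map_apply hf (measurableSet_lt measurable_const measurable_id'), measure_eq_zero_iff_ae_notMem]
    filter_upwards [hμ] with x hx using not_lt.2 (sum_mul_mem_Icc hpos hx).2

lemma bddAbove_variance_scalarAdmissible {n : ℕ} (h : Fin n → ℝ) (A E : ℝ) :
    BddAbove ((fun μ : Measure ℝ => variance id μ) '' {μ | scalarAdmissible h A E μ}) := by
  refine ⟨((sCum h n * A - 0) / 2) ^ 2, ?_⟩
  rintro _ ⟨μ, ⟨_, h0, htop, _⟩, rfl⟩
  refine variance_le_sq_of_bounded ?_ aemeasurable_id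
  filter_upwards [h0, measure_eq_zero_iff_ae_notMem.1 htop] with x hx hx' using ⟨hx, not_lt.1 hx'⟩

theorem miso_capacity_upper_bound_vmax (n : ℕ) (hn : 2 ≤ n) (h : Fin n → ℝ)
    (hord : ∀ i j : Fin n, i ≤ j → h j ≤ h i) (hpos : ∀ k, 0 < h k)
    (v : ℝ≥0) (hv : 0 < v)
    (A α : ℝ) (hA : 0 < A) (hα0 : 0 < α) (hαn : α < (n : ℝ) / 2) :
    misoCapacity h v A (α * A)
      ≤ ((1 / 2 * Real.log (1 + Vmax h A (α * A) / (v : ℝ)) : ℝ) : EReal) := by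
  refine iSup₂_le fun μ ⟨hprob, hbox, hE⟩ => ?_
  have hμ : ∀ᵐ x ∂μ, ∀ k, x k ∈ Set.Icc 0 A := ae_all_iff.2 hbox
  have hf : Measurable fun x : Fin n → ℝ => ∑ k, h k * x k := by fun_prop
  have hf2 : MemLp (fun x : Fin n → ℝ => ∑ k, h k * x k) 2 μ := by
    refine MemLp.of_bound hf.aestronglyMeasurable (sCum h n * A) ?_
    filter_upwards [hμ] with x hx
    rw [Real.norm_of_nonneg (sum_mul_mem_Icc hpos hx).1]
    exact (sum_mul_mem_Icc hpos hx).2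
  refine (mutualInfo_misoJoint_le h hv.ne' μ hf2).trans (EReal.coe_le_coe_iff.2 ?_)
  have hvar : Var[fun x => ∑ k, h k * x k; μ] ≤ Vmax h A (α * A) := by
    have := le_csSup (bddAbove_variance_scalarAdmissible h A (α * A))
      (Set.mem_image_of_mem _ (scalarAdmissible_map hord hpos hA.le μ hμ hE))
    rwa [variance_map aemeasurable_id hf.aemeasurable] at this
  have hV := variance_nonneg (fun x : Fin n → ℝ => ∑ k, h k * x k) μ
  have hv' : (0 : ℝ) < v := hv
  gcongr
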